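/- Let k \ge 2 be an integer. The number of simultaneous-conjugacy classes of transitive triples (\sigma_1, \sigma_2, \sigma_3) in S_{2k} with \sigma_1 \circ \sigma_2 = \sigma_3 such that \sigma_1 has cycle type (k, k-1, 1), \sigma_2 has cycle type (4, 2, \ldots, 2) consisting of one 4-cycle and k-2 transpositions, and \sigma_3 is a fixed-point-free involution with cycle type (2, \ldots, 2) consisting of k transpositions, equals 1. -/

import Mathlib

/-- The cycle type of a permutation of `Fin d` *including fixed points as parts equal
to 1*: the partition of `d` formed by the lengths of all cycles of `σ`. -/
def fullCycleType {d : ℕ} (σ : Equiv.Perm (Fin d)) : Multiset ℕ :=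
  σ.cycleType + Multiset.replicate (d - σ.cycleType.sum) 1

/-- The subgroup generated by `σ₁` and `σ₂` acts transitively on the `d` letters. -/
def IsTransitivePair {d : ℕ} (σ₁ σ₂ : Equiv.Perm (Fin d)) : Prop :=
  ∀ x y : Fin d, ∃ τ ∈ Subgroup.closure ({σ₁, σ₂} : Set (Equiv.Perm (Fin d))), τ x = y

/-- Transitive triples `(σ₁, σ₂, σ₃)` in `S_d` with `σ₁ ∘ σ₂ = σ₃` and prescribed
cycle types `t₁, t₂, t₃` (fixed points included as parts equal to 1). -/
def HurwitzTriples (d : ℕ) (t₁ t₂ t₃ : Multiset ℕ) :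
    Set (Equiv.Perm (Fin d) × Equiv.Perm (Fin d) × Equiv.Perm (Fin d)) :=
  {p | p.1 * p.2.1 = p.2.2 ∧ fullCycleType p.1 = t₁ ∧ fullCycleType p.2.1 = t₂ ∧
    fullCycleType p.2.2 = t₃ ∧ IsTransitivePair p.1 p.2.1}

/-- Simultaneous conjugation of triples: `(σ₁,σ₂,σ₃) ∼ (τσ₁τ⁻¹, τσ₂τ⁻¹, τσ₃τ⁻¹)`. -/
def SimConj {d : ℕ} (S : Set (Equiv.Perm (Fin d) × Equiv.Perm (Fin d) × Equiv.Perm (Fin d)))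
    (p q : S) : Prop :=
  ∃ τ : Equiv.Perm (Fin d),
    q.1.1 = τ * p.1.1 * τ⁻¹ ∧ q.1.2.1 = τ * p.1.2.1 * τ⁻¹ ∧ q.1.2.2 = τ * p.1.2.2 * τ⁻¹

open Equiv Equiv.Perm

theorem cycleType_permCongr {α β : Type*} [Fintype α] [DecidableEq α] [Fintype β]
    [DecidableEq β] (e : α ≃ β) (σ : Perm α) : (e.permCongr σ).cycleType = σ.cycleType := by
  rw [← cycleType_extendDomain (p := fun _ : β => True)
    (e.trans (Equiv.subtypeUnivEquiv fun _ => trivial).symm)]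
  refine congrArg _ (Equiv.ext fun x => ?_)
  rw [extendDomain_apply_subtype _ _ trivial]
  simp [Equiv.subtypeUnivEquiv]

theorem cycleType_sumCongr {α β : Type*} [Fintype α] [DecidableEq α] [Fintype β]
    [DecidableEq β] (σ : Perm α) (τ : Perm β) :
    (Perm.sumCongr σ τ).cycleType = σ.cycleType + τ.cycleType := by
  have hσ : (Perm.sumCongr σ (1 : Perm β)).cycleType = σ.cycleType := by
    rw [← cycleType_extendDomain (Equiv.ofInjective _ (Sum.inl_injective (α := α) (β := β)))]
    refine congrArg Perm.cycleType (Equiv.ext fun x => ?_)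
    rcases x with x | x
    · exact (extendDomain_apply_image σ (Equiv.ofInjective _ Sum.inl_injective) x).symm
    · rw [extendDomain_apply_not_subtype _ _ (by simp)]; simp
  have hτ : (Perm.sumCongr (1 : Perm α) τ).cycleType = τ.cycleType := by
    rw [← cycleType_extendDomain (Equiv.ofInjective _ (Sum.inr_injective (α := α) (β := β)))]
    refine congrArg Perm.cycleType (Equiv.ext fun x => ?_)
    rcases x with x | x
    · rw [extendDomain_apply_not_subtype _ _ (by simp)]; simp
    · exact (extendDomain_apply_image τ (Equiv.ofInjective _ Sum.inr_injective) x).symm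
  have hd : Disjoint (Perm.sumCongr σ (1 : Perm β)) (Perm.sumCongr (1 : Perm α) τ) := by
    rintro (x | x) <;> simp
  rw [← hσ, ← hτ, ← hd.cycleType_mul, Perm.sumCongr_mul, mul_one, one_mul]

theorem exists_equiv_of_involutions {X : Type*} [Fintype X] {n : ℕ}
    (hcard : Fintype.card X = 2 * (n + 2)) (s c : Perm X)
    (hs : ∀ x, s (s x) = x) (hs' : ∀ x, s x ≠ x) (hc : ∀ x, c (c x) = x) (hc' : ∀ x, c x ≠ x)
    (x₀ : X)
    (htrans : ∀ S : Set X, x₀ ∈ S → (∀ x ∈ S, s x ∈ S) → (∀ x ∈ S, c x ∈ S) → ∀ x, x ∈ S) :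
    ∃ e : Fin (n + 2) ⊕ Fin (n + 2) ≃ X, e (.inl 0) = x₀ ∧
      (∀ i, c (e (.inl i)) = e (.inr i)) ∧ ∀ i, s (e (.inr i)) = e (.inl (i + 1)) := by
  classical
  set f : X → X := fun x => s (c x) with hf
  have hfix : ∀ (j : ℕ) (x : X), c x ≠ f^[j] x := by
    intro j
    induction j using Nat.twoStepInduction with
    | zero => exact hc'
    | one => exact fun x h => hs' (c x) h.symm
    | more j ih _ =>
      intro x h
      rw [Function.iterate_succ_apply] at h
      refine ih (f x) ?_
      rw [← Function.iterate_succ_apply, Function.iterate_succ_apply'] at h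
      rw [hf] at h ⊢
      have h1 := congrArg s h
      simp only [hs] at h1
      have h2 := congrArg c h1
      simp only [hc] at h2
      exact h2
  have hcross : ∀ i j : ℕ, c (f^[i] x₀) ≠ f^[j] x₀ := by
    intro i j h
    rcases le_total i j with hij | hij
    · obtain ⟨l, rfl⟩ := Nat.exists_eq_add_of_le' hij
      rw [Function.iterate_add_apply] at h
      exact hfix l _ h
    · obtain ⟨l, rfl⟩ := Nat.exists_eq_add_of_le' hij
      rw [Function.iterate_add_apply] at h
      exact hfix l (f^[j] x₀) (by rw [← hc (f^[l] (f^[j] x₀)), h])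
  have hfinj : Function.Injective f := s.injective.comp c.injective
  obtain ⟨m, hm, hinj, hmod⟩ : ∃ m : ℕ, 0 < m ∧
      (∀ i < m, ∀ j < m, f^[i] x₀ = f^[j] x₀ → i = j) ∧ ∀ i, f^[i % m] x₀ = f^[i] x₀ :=
    ⟨Function.minimalPeriod f x₀,
      Function.minimalPeriod_pos_of_mem_periodicPts (hfinj.mem_periodicPts x₀),
      fun i hi j hj h => Function.iterate_injOn_Iio_minimalPeriod hi hj h,
      fun i => Function.iterate_mod_minimalPeriod_eq⟩
  let g : Fin m ⊕ Fin m → X := Sum.elim (fun i => f^[i] x₀) (fun i => c (f^[i] x₀))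
  have hg : Function.Bijective g := by
    constructor
    · rintro (i | i) (j | j) h
      · exact congrArg _ (Fin.ext (hinj i i.2 j j.2 h))
      · exact absurd h.symm (hcross _ _)
      · exact absurd h (hcross _ _)
      · exact congrArg _ (Fin.ext (hinj i i.2 j j.2 (c.injective h)))
    · have hl : ∀ i, f^[i] x₀ ∈ Set.range g := fun i =>
        ⟨.inl ⟨i % m, Nat.mod_lt _ hm⟩, hmod i⟩
      have hr : ∀ i, c (f^[i] x₀) ∈ Set.range g := fun i =>
        ⟨.inr ⟨i % m, Nat.mod_lt _ hm⟩, congrArg c (hmod i)⟩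
      refine htrans _ (hl 0) ?_ ?_
      · rintro _ ⟨i | i, rfl⟩
        · have : f^[(i : ℕ)] x₀ = f (f^[i + (m - 1)] x₀) := by
            rw [← Function.iterate_succ_apply' f, ← hmod, Nat.succ_eq_add_one,
              show (i : ℕ) + (m - 1) + 1 = i + m by omega, ← hmod (i + m), Nat.add_mod_right, hmod]
          have h2 : s (g (.inl i)) = c (f^[i + (m - 1)] x₀) := by
            change s (f^[(i : ℕ)] x₀) = _
            rw [this]; exact hs _
          rw [h2]; exact hr _
        · have := hl (i + 1)
          rwa [Function.iterate_succ_apply'] at this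
      · rintro _ ⟨i | i, rfl⟩
        · exact hr i
        · change c (c _) ∈ _
          rw [hc]; exact hl i
  have hcm := Fintype.card_of_bijective hg
  rw [Fintype.card_sum, Fintype.card_fin, hcard] at hcm
  obtain rfl : m = n + 2 := by omega
  refine ⟨Equiv.ofBijective g hg, rfl, fun i => rfl, fun i => ?_⟩
  change f (f^[(i : ℕ)] x₀) = f^[((i + 1 : Fin (n + 2)) : ℕ)] x₀
  rw [Fin.val_add, hmod, ← Function.iterate_succ_apply' f]
  rfl

theorem cycleType_eq_of_fullCycleType_eq {d : ℕ} {σ : Perm (Fin d)} {t : Multiset ℕ}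
    (ht : 1 ∉ t) (h : fullCycleType σ = t) : σ.cycleType = t ∧ ∀ x, σ x ≠ x := by
  have h0 : d - σ.cycleType.sum = 0 := by
    by_contra h0
    exact ht (h ▸ Multiset.mem_add.2 (.inr (Multiset.mem_replicate.2 ⟨h0, rfl⟩)))
  refine ⟨by simpa [fullCycleType, h0] using h, fun x => ?_⟩
  have hcard : σ.support = Finset.univ := by
    rw [← Finset.card_eq_iff_eq_univ, Fintype.card_fin, ← sum_cycleType]
    have := σ.sum_cycleType_le
    rw [Fintype.card_fin] at this
    omega
  exact mem_support.1 (hcard ▸ Finset.mem_univ x)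

theorem fullCycleType_eq_of_cycleType_eq {d : ℕ} {σ : Perm (Fin d)} {t : Multiset ℕ} {m : ℕ}
    (h : σ.cycleType = t) (ht : t.sum + m = d) :
    fullCycleType σ = t + Multiset.replicate m 1 := by
  rw [fullCycleType, h, ← ht, Nat.add_sub_cancel_left]

theorem cycleType_of_involutive {X : Type*} [Fintype X] [DecidableEq X] {c : Perm X} {m : ℕ}
    (hX : Fintype.card X = 2 * m) (hc : ∀ x, c (c x) = x) (hc' : ∀ x, c x ≠ x) :
    c.cycleType = Multiset.replicate m 2 := by
  have h := cycleType_of_pow_prime_eq_one (σ := c) (p := 2) (by ext x; simp [pow_two, hc])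
  have hs := c.sum_cycleType
  have hsupp : c.support = Finset.univ := by ext x; simp [hc']
  rw [hsupp, Finset.card_univ, hX, h, Multiset.sum_replicate, smul_eq_mul] at hs
  rw [h, show c.cycleType.card = m by omega]

/-- The permutation `b` cyclically permutes the four distinct points `p, b p, b² p, b³ p` and
acts as an involution away from them. -/
structure IsFourCycleAt {X : Type*} (b : Perm X) (p : X) : Prop where
  pow_four : b (b (b (b p))) = p
  sq_ne : b (b p) ≠ p
  involutive : ∀ x, x ≠ p → x ≠ b p → x ≠ b (b p) → x ≠ b (b (b p)) → b (b x) = x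

theorem IsFourCycleAt.cycleType {X : Type*} [Fintype X] [DecidableEq X] {b : Perm X} {p : X}
    {m : ℕ} (h : IsFourCycleAt b p) (hX : Fintype.card X = 2 * (m + 2)) (hb : ∀ x, b x ≠ x) :
    b.cycleType = 4 ::ₘ Multiset.replicate m 2 := by
  obtain ⟨h4, h2, hinv⟩ := h
  have h01 := hb p
  have h12 := hb (b p)
  have h23 := hb (b (b p))
  have h13 : b (b (b p)) ≠ b p := fun h => h2 (b.injective h)
  have h30 : b (b (b p)) ≠ p := fun h => hb p (by rw [h] at h4; exact h4)
  have hnd : [p, b p, b (b p), b (b (b p))].Nodup := by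
    simp [h01.symm, h12.symm, h23.symm, h13.symm, h30.symm, h2.symm]
  set c := [p, b p, b (b p), b (b (b p))].formPerm with hcdef
  have hcyc : c.IsCycle := List.isCycle_formPerm hnd (by simp)
  have hsupp : c.support = [p, b p, b (b p), b (b (b p))].toFinset :=
    List.support_formPerm_of_nodup _ hnd (by simp)
  have hccard : c.support.card = 4 := by
    rw [hsupp, List.toFinset_card_of_nodup hnd]; rfl
  have hcb : ∀ x ∈ c.support, c x = b x := by
    intro x hx
    rw [hsupp] at hx
    simp only [List.mem_toFinset, List.mem_cons, List.not_mem_nil, or_false] at hx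
    rcases hx with rfl | rfl | rfl | rfl <;>
      simp [hcdef, List.formPerm_cons_cons, swap_apply_def, h01.symm, h12.symm, h13.symm,
        h30.symm, h2.symm, h12, h23, h13, h30, h2, h4]
  have hmem : ∀ x, x ∉ c.support → b (b x) = x := by
    intro x hx
    simp only [hsupp, List.mem_toFinset, List.mem_cons, List.not_mem_nil, or_false, not_or] at hx
    exact hinv x hx.1 hx.2.1 hx.2.2.1 hx.2.2.2
  have hbs : ∀ x, x ∉ c.support → b x ∉ c.support := by
    intro x hx hx'
    obtain ⟨y, hy, hyx⟩ : ∃ y ∈ c.support, c y = b x :=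
      ⟨c⁻¹ (b x), by rw [← support_inv, apply_mem_support, support_inv]; exact hx', by simp⟩
    rw [hcb y hy] at hyx
    exact hx (b.injective hyx ▸ hy)
  have hτ1 : ∀ x ∈ c.support, (c⁻¹ * b) x = x := fun x hx => by
    rw [Perm.mul_apply, ← hcb x hx]; exact c.symm_apply_apply x
  have hτ2 : ∀ x, x ∉ c.support → (c⁻¹ * b) x = b x := fun x hx => by
    rw [Perm.mul_apply, Perm.inv_eq_iff_eq]
    exact (notMem_support.1 (hbs x hx)).symm
  have hdisj : Disjoint c (c⁻¹ * b) := fun x => by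
    by_cases hx : x ∈ c.support
    · exact .inr (hτ1 x hx)
    · exact .inl (notMem_support.1 hx)
  have hτ := cycleType_of_pow_prime_eq_one (σ := c⁻¹ * b) (p := 2) (by
    ext x
    rw [pow_two, Perm.mul_apply, Perm.one_apply]
    by_cases hx : x ∈ c.support
    · rw [hτ1 x hx, hτ1 x hx]
    · rw [hτ2 x hx, hτ2 _ (hbs x hx), hmem x hx])
  have hbt : b.cycleType = 4 ::ₘ Multiset.replicate (c⁻¹ * b).cycleType.card 2 := by
    rw [← hτ, ← Multiset.singleton_add, ← hccard, ← hcyc.cycleType, ← hdisj.cycleType_mul,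
      mul_inv_cancel_left]
  have hs := b.sum_cycleType
  have hsupp : b.support = Finset.univ := by ext x; simp [hb]
  rw [hsupp, Finset.card_univ, hX, hbt, Multiset.sum_cons, Multiset.sum_replicate,
    smul_eq_mul] at hs
  rw [hbt, show (c⁻¹ * b).cycleType.card = m by omega]

theorem isFourCycleAt_or_of_cycleType {X : Type*} [Fintype X] [DecidableEq X] {b : Perm X}
    {m : ℕ} (h : b.cycleType = 4 ::ₘ Multiset.replicate m 2) (x : X) :
    IsFourCycleAt b x ∨ b (b x) = x := by
  obtain ⟨c, τ, rfl, hd, hc, hcard⟩ := mem_cycleType_iff.1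
    (show 4 ∈ b.cycleType from h ▸ Multiset.mem_cons_self _ _)
  rw [hd.cycleType_mul, hc.cycleType, hcard, Multiset.singleton_add, Multiset.cons_inj_right] at h
  have hτ2 : τ ^ 2 = 1 := pow_prime_eq_one_iff.2 fun n hn => Multiset.eq_of_mem_replicate (h ▸ hn)
  have hτ : ∀ y, τ (τ y) = y := fun y => by
    rw [← Perm.mul_apply, ← pow_two, hτ2, Perm.one_apply]
  have hbτ : ∀ y, y ∉ c.support → (c * τ) y = τ y := fun y hy => by
    rw [hd.commute.eq, Perm.mul_apply, notMem_support.1 hy]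
  have hbc : ∀ y ∈ c.support, (c * τ) y = c y := fun y hy => by
    rw [Perm.mul_apply, (hd y).resolve_left (mem_support.1 hy)]
  have hτs : ∀ y, y ∉ c.support → τ y ∉ c.support := fun y hy hy' => by
    have := (hd (τ y)).resolve_left (mem_support.1 hy')
    rw [τ.injective this] at hy'
    exact hy hy'
  have hout : ∀ y, y ∉ c.support → (c * τ) ((c * τ) y) = y := fun y hy => by
    rw [hbτ y hy, hbτ _ (hτs y hy), hτ]
  by_cases hx : x ∈ c.support
  · left
    have hord : orderOf c = 4 := hc.orderOf.trans hcard
    have e1 : (c * τ) x = c x := hbc x hx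
    have e2 : (c * τ) (c x) = c (c x) := hbc _ (by simpa using hx)
    have e3 : (c * τ) (c (c x)) = c (c (c x)) := hbc _ (by simpa using hx)
    have e4 : (c * τ) (c (c (c x))) = c (c (c (c x))) := hbc _ (by simpa using hx)
    have hc4 : c ^ 4 = 1 := hord ▸ pow_orderOf_eq_one c
    refine ⟨?_, ?_, ?_⟩
    · rw [e1, e2, e3, e4]
      exact congrArg (fun g : Perm X => g x) hc4
    · rw [e1, e2]
      intro hxx
      have : c ^ 2 = 1 := (hc.pow_eq_one_iff' (mem_support.1 hx)).2 hxx
      have := orderOf_dvd_of_pow_eq_one this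
      rw [hord] at this
      omega
    · rw [e1, e2, e3]
      intro y h0 h1 h2 h3
      apply hout
      intro hy
      obtain ⟨i, hi, rfl⟩ :=
        (hc.sameCycle (mem_support.1 hx) (mem_support.1 hy)).exists_pow_eq'
      rw [hord] at hi
      interval_cases i
      exacts [h0 rfl, h1 rfl, h2 rfl, h3 rfl]
  · exact .inr (hout x hx)

/-- The model fixed-point-free involution exchanging the two copies of `Fin (n + 2)`. -/
def modelFlip (n : ℕ) : Perm (Fin (n + 2) ⊕ Fin (n + 2)) := Equiv.sumComm _ _

/-- The model fixed-point-free involution pairing `inr i` with `inl (i + 1)`. -/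
def modelShift (n : ℕ) : Perm (Fin (n + 2) ⊕ Fin (n + 2)) :=
  Perm.sumCongr (finRotate (n + 2)) (finRotate (n + 2))⁻¹ * modelFlip n

/-- The model permutation of cycle type `(4, 2, …, 2)`. -/
def modelVertex (n : ℕ) : Perm (Fin (n + 2) ⊕ Fin (n + 2)) :=
  modelShift n * swap (.inl (Fin.last (n + 1))) (.inl 0)

/-- The model permutation of cycle type `(n + 2, n + 1, 1)`. -/
def modelFace (n : ℕ) : Perm (Fin (n + 2) ⊕ Fin (n + 2)) := modelFlip n * (modelVertex n)⁻¹

@[simp] theorem modelFlip_inl (n : ℕ) (i : Fin (n + 2)) : modelFlip n (.inl i) = .inr i := rfl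

@[simp] theorem modelFlip_inr (n : ℕ) (i : Fin (n + 2)) : modelFlip n (.inr i) = .inl i := rfl

@[simp] theorem modelShift_inr (n : ℕ) (i : Fin (n + 2)) :
    modelShift n (.inr i) = .inl (i + 1) := by
  simp [modelShift]

@[simp] theorem modelShift_inl (n : ℕ) (i : Fin (n + 2)) :
    modelShift n (.inl i) = .inr (i - 1) := by
  simp [modelShift, Perm.inv_def]

theorem cycleType_modelFlip (n : ℕ) :
    (modelFlip n).cycleType = Multiset.replicate (n + 2) 2 :=
  cycleType_of_involutive (by simp [two_mul]) (by rintro (i | i) <;> rfl)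
    (by rintro (i | i) <;> simp)

theorem modelShift_ne (n : ℕ) (x) : modelShift n x ≠ x := by
  rcases x with i | i <;> simp

theorem modelVertex_ne (n : ℕ) (x) : modelVertex n x ≠ x := by
  rw [modelVertex, Perm.mul_apply, swap_apply_def]
  split_ifs with h1 h2
  · subst h1; simp
  · subst h2; simp
  · exact modelShift_ne n x

theorem modelVertex_inr (n : ℕ) (i : Fin (n + 2)) : modelVertex n (.inr i) = .inl (i + 1) := by
  rw [modelVertex, Perm.mul_apply, swap_apply_of_ne_of_ne (by simp) (by simp), modelShift_inr]

theorem modelVertex_inl_zero (n : ℕ) :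
    modelVertex n (.inl 0) = .inr (Fin.last (n + 1) - 1) := by
  rw [modelVertex, Perm.mul_apply, swap_apply_right, modelShift_inl]

theorem modelVertex_inl_last (n : ℕ) :
    modelVertex n (.inl (Fin.last (n + 1))) = .inr (Fin.last (n + 1)) := by
  rw [modelVertex, Perm.mul_apply, swap_apply_left, modelShift_inl, zero_sub,
    neg_eq_of_add_eq_zero_left (Fin.last_add_one _)]

theorem modelVertex_inl_of_ne (n : ℕ) {i : Fin (n + 2)} (h0 : i ≠ 0) (hl : i ≠ Fin.last (n + 1)) :
    modelVertex n (.inl i) = .inr (i - 1) := by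
  rw [modelVertex, Perm.mul_apply, swap_apply_of_ne_of_ne (by simpa using hl) (by simpa using h0),
    modelShift_inl]

theorem isFourCycleAt_modelVertex (n : ℕ) :
    IsFourCycleAt (modelVertex n) (.inr (Fin.last (n + 1))) := by
  have e1 : modelVertex n (.inr (Fin.last (n + 1))) = .inl 0 := by
    rw [modelVertex_inr, Fin.last_add_one]
  have e2 := modelVertex_inl_zero n
  have e3 : modelVertex n (.inr (Fin.last (n + 1) - 1)) = .inl (Fin.last (n + 1)) := by
    rw [modelVertex_inr, sub_add_cancel]
  have e4 := modelVertex_inl_last n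
  refine ⟨by rw [e1, e2, e3, e4], by simp [e1, e2], ?_⟩
  rw [e1, e2, e3]
  rintro (i | i) h0 h1 h2 h3
  · rw [modelVertex_inl_of_ne n (by simpa using h1) (by simpa using h3), modelVertex_inr,
      sub_add_cancel]
  · rw [modelVertex_inr, modelVertex_inl_of_ne, add_sub_cancel_right]
    · intro h
      refine h0 (congrArg _ ?_)
      rw [← Fin.last_add_one] at h
      exact add_right_cancel h
    · intro h
      exact h2 (congrArg _ (eq_sub_of_add_eq h))

theorem cycleType_modelVertex (n : ℕ) :
    (modelVertex n).cycleType = 4 ::ₘ Multiset.replicate n 2 :=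
  (isFourCycleAt_modelVertex n).cycleType (by simp [two_mul]) (modelVertex_ne n)

theorem modelFace_eq (n : ℕ) :
    modelFace n = Perm.sumCongr (finRotate (n + 2))⁻¹ (Fin.castSucc (Fin.last n)).cycleRange := by
  have hlast : Fin.last (n + 1) - 1 = Fin.castSucc (Fin.last n) := by
    rw [sub_eq_iff_eq_add, Fin.coeSucc_eq_succ, Fin.succ_last]
  rw [modelFace, mul_inv_eq_iff_eq_mul]
  refine Equiv.ext fun x => ?_
  rw [Perm.mul_apply]
  rcases x with i | i
  · by_cases h0 : i = 0
    · subst h0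
      rw [modelVertex_inl_zero, hlast]
      simp
    by_cases hl : i = Fin.last (n + 1)
    · subst hl
      rw [modelVertex_inl_last]
      simp [Fin.cycleRange_of_gt (Fin.castSucc_lt_last (Fin.last n))]
    · rw [modelVertex_inl_of_ne n h0 hl]
      have hlt : i - 1 < Fin.castSucc (Fin.last n) := by
        rw [← hlast]
        obtain ⟨j, rfl⟩ := Fin.exists_succ_eq.2 h0
        rw [← Fin.coeSucc_eq_succ, add_sub_cancel_right, hlast]
        refine Fin.castSucc_lt_castSucc_iff.2 (Fin.lt_last_iff_ne_last.2 ?_)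
        rintro rfl
        exact hl (Fin.succ_last _)
      simp [Fin.cycleRange_of_lt hlt]
  · rw [modelVertex_inr]
    simp [Perm.inv_def]

theorem fullCycleType_permCongr_modelFace (n : ℕ)
    (e : Fin (n + 2) ⊕ Fin (n + 2) ≃ Fin (2 * (n + 2))) :
    fullCycleType (e.permCongr (modelFace n)) = {n + 2, n + 1, 1} := by
  have h : (e.permCongr (modelFace n)).cycleType =
      {n + 2} + (Fin.castSucc (Fin.last n)).cycleRange.cycleType := by
    rw [cycleType_permCongr, modelFace_eq, cycleType_sumCongr, cycleType_inv, cycleType_finRotate]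
  rcases Nat.eq_zero_or_pos n with rfl | hn
  · rw [show Fin.castSucc (Fin.last 0) = 0 from rfl, Fin.cycleRange_zero, cycleType_one] at h
    rw [fullCycleType_eq_of_cycleType_eq h (m := 2) (by simp)]
    rfl
  · rw [Fin.cycleType_cycleRange (by simp [Fin.ext_iff]; omega)] at h
    rw [fullCycleType_eq_of_cycleType_eq h (m := 1) (by simp; omega)]
    rfl

theorem modelFace_inl (n : ℕ) (i : Fin (n + 2)) : modelFace n (.inl (i + 1)) = .inl i := by
  simp [modelFace_eq, Perm.inv_def]

theorem mem_hurwitzTriples_model (n : ℕ)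
    (e : Fin (n + 2) ⊕ Fin (n + 2) ≃ Fin (2 * (n + 2))) :
    (e.permCongr (modelFace n), e.permCongr (modelVertex n), e.permCongr (modelFlip n)) ∈
      HurwitzTriples (2 * (n + 2)) {n + 2, n + 1, 1} (4 ::ₘ Multiset.replicate n 2)
        (Multiset.replicate (n + 2) 2) := by
  have hmul : e.permCongr (modelFace n) * e.permCongr (modelVertex n) =
      e.permCongr (modelFlip n) := by
    rw [← Equiv.permCongr_mul, modelFace, inv_mul_cancel_right]
  refine ⟨hmul, fullCycleType_permCongr_modelFace n e, ?_, ?_, ?_⟩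
  · rw [fullCycleType_eq_of_cycleType_eq (m := 0)
      ((cycleType_permCongr _ _).trans (cycleType_modelVertex n)) (by simp; omega)]
    simp
  · rw [fullCycleType_eq_of_cycleType_eq (m := 0)
      ((cycleType_permCongr _ _).trans (cycleType_modelFlip n)) (by simp; omega)]
    simp
  · set H := Subgroup.closure {e.permCongr (modelFace n), e.permCongr (modelVertex n)} with hH
    have hface : e.permCongr (modelFace n) ∈ H := Subgroup.subset_closure (by simp)
    have hflip : e.permCongr (modelFlip n) ∈ H :=
      hmul ▸ H.mul_mem hface (Subgroup.subset_closure (by simp))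
    have hl : ∀ i : Fin (n + 2), ∃ τ ∈ H, τ (e (.inl i)) = e (.inl 0) := by
      intro i
      induction i using Fin.induction with
      | zero => exact ⟨1, H.one_mem, rfl⟩
      | succ i ih =>
        obtain ⟨τ, hτ, h⟩ := ih
        refine ⟨τ * _, H.mul_mem hτ hface, ?_⟩
        rw [Perm.mul_apply, Equiv.permCongr_apply, Equiv.symm_apply_apply, ← Fin.coeSucc_eq_succ,
          modelFace_inl, h]
    have hall : ∀ x, ∃ τ ∈ H, τ x = e (.inl 0) := by
      intro x
      obtain ⟨i | i, rfl⟩ := e.surjective x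
      · exact hl i
      · obtain ⟨τ, hτ, h⟩ := hl i
        refine ⟨τ * _, H.mul_mem hτ hflip, ?_⟩
        rw [Perm.mul_apply, Equiv.permCongr_apply, Equiv.symm_apply_apply, modelFlip_inr, h]
    intro x y
    obtain ⟨τ, hτ, hx⟩ := hall x
    obtain ⟨ρ, hρ, hy⟩ := hall y
    refine ⟨ρ⁻¹ * τ, H.mul_mem (H.inv_mem hρ) hτ, ?_⟩
    rw [Perm.mul_apply, hx, Perm.inv_eq_iff_eq, hy]

open Pointwise in
theorem IsTransitivePair.mem_of_mapsTo {d : ℕ} {a b : Perm (Fin d)} (h : IsTransitivePair a b)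
    {S : Set (Fin d)} {x : Fin d} (hx : x ∈ S) (hb : ∀ y ∈ S, b y ∈ S)
    (hab : ∀ y ∈ S, (a * b) y ∈ S) (y : Fin d) : y ∈ S := by
  have hb' : b ∈ MulAction.stabilizer (Perm (Fin d)) S :=
    (MulAction.mem_stabilizer_set' S.toFinite).2 fun y hy => hb y hy
  have hab' : a * b ∈ MulAction.stabilizer (Perm (Fin d)) S :=
    (MulAction.mem_stabilizer_set' S.toFinite).2 fun y hy => hab y hy
  have ha' : a ∈ MulAction.stabilizer (Perm (Fin d)) S :=
    (Subgroup.mul_mem_cancel_right _ hb').1 hab'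
  obtain ⟨τ, hτ, rfl⟩ := h x y
  have hle : Subgroup.closure {a, b} ≤ MulAction.stabilizer (Perm (Fin d)) S := by
    rw [Subgroup.closure_le]
    rintro _ (rfl | rfl)
    exacts [ha', hb']
  exact (MulAction.mem_stabilizer_set' S.toFinite).1 (hle hτ) hx

theorem exists_permCongr_eq_of_mem_hurwitzTriples {n : ℕ}
    {p : Perm (Fin (2 * (n + 2))) × Perm (Fin (2 * (n + 2))) × Perm (Fin (2 * (n + 2)))}
    (hp : p ∈ HurwitzTriples (2 * (n + 2)) {n + 2, n + 1, 1} (4 ::ₘ Multiset.replicate n 2)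
        (Multiset.replicate (n + 2) 2)) :
    ∃ e : Fin (n + 2) ⊕ Fin (n + 2) ≃ Fin (2 * (n + 2)),
      p = (e.permCongr (modelFace n), e.permCongr (modelVertex n), e.permCongr (modelFlip n)) := by
  obtain ⟨a, b, c⟩ := p
  obtain ⟨hmul, ha, hb, hc, htr⟩ := hp
  dsimp only at hmul ha hb hc htr
  obtain ⟨hbt, hb⟩ := cycleType_eq_of_fullCycleType_eq (by simp [Multiset.mem_replicate]) hb
  obtain ⟨hct, hc⟩ := cycleType_eq_of_fullCycleType_eq (by simp [Multiset.mem_replicate]) hc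
  have hc2 : ∀ y, c (c y) = y := fun y => by
    have : c ^ 2 = 1 :=
      pow_prime_eq_one_iff.2 fun n hn => Multiset.eq_of_mem_replicate (hct ▸ hn)
    rw [← Perm.mul_apply, ← pow_two, this, Perm.one_apply]
  obtain ⟨q, hq⟩ : ∃ q, a q = q := by
    by_contra! hne
    have hsupp : a.support = Finset.univ := by ext x; simp [hne]
    have h1 : 1 ∈ fullCycleType a := by rw [ha]; simp
    rw [fullCycleType, sum_cycleType, hsupp, Finset.card_univ, Fintype.card_fin, Nat.sub_self,
      Multiset.replicate_zero, add_zero] at h1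
    exact absurd (one_lt_of_mem_cycleType h1) (lt_irrefl 1)
  have hbcq : b (c q) = q := by
    refine a.injective ?_
    rw [← Perm.mul_apply, hmul, hc2, hq]
  have hfour : IsFourCycleAt b q := by
    refine (isFourCycleAt_or_of_cycleType hbt q).resolve_right fun hbb => ?_
    have hbq : b q = c q := b.injective (hbb.trans hbcq.symm)
    have hS := htr.mem_of_mapsTo (S := {q, c q}) (x := q) (by simp)
      (by rintro _ (rfl | rfl) <;> simp [hbq, hbcq])
      (by rw [hmul]; rintro _ (rfl | rfl) <;> simp [hc2])
    have hcard : Fintype.card (Fin (2 * (n + 2))) ≤ ({q, c q} : Finset _).card :=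
      Finset.card_le_card fun y _ => by simpa using hS y
    have := hcard.trans Finset.card_le_two
    rw [Fintype.card_fin] at this
    omega
  obtain ⟨h4, h2, hinv⟩ := hfour
  have hcq : c q = b (b (b q)) := b.injective (hbcq.trans h4.symm)
  have h30 : b (b (b q)) ≠ q := hcq ▸ hc q
  set s := b * swap (b (b (b q))) (b q) with hs
  have s1 : s q = b q := by
    rw [hs, Perm.mul_apply, swap_apply_of_ne_of_ne h30.symm (hb q).symm]
  have s2 : s (b q) = q := by rw [hs, Perm.mul_apply, swap_apply_right, h4]
  have s3 : s (b (b q)) = b (b (b q)) := by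
    rw [hs, Perm.mul_apply, swap_apply_of_ne_of_ne (hb _).symm (hb _)]
  have s4 : s (b (b (b q))) = b (b q) := by rw [hs, Perm.mul_apply, swap_apply_left]
  have s5 : ∀ y, y ≠ b q → y ≠ b (b (b q)) → s y = b y := fun y h h' => by
    rw [hs, Perm.mul_apply, swap_apply_of_ne_of_ne h' h]
  have hss : ∀ y, s (s y) = y ∧ s y ≠ y := by
    intro y
    by_cases y0 : y = q
    · subst y0; rw [s1, s2]; exact ⟨rfl, hb _⟩
    by_cases y1 : y = b q
    · subst y1; rw [s2, s1]; exact ⟨rfl, (hb _).symm⟩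
    by_cases y2 : y = b (b q)
    · subst y2; rw [s3, s4]; exact ⟨rfl, hb _⟩
    by_cases y3 : y = b (b (b q))
    · subst y3; rw [s4, s3]; exact ⟨rfl, (hb _).symm⟩
    rw [s5 y y1 y3]
    refine ⟨?_, hb y⟩
    rw [s5 _ (fun h => y0 (b.injective h)) (fun h => y2 (b.injective h)), hinv y y0 y1 y2 y3]
  obtain ⟨e, he0, hec, hes⟩ := exists_equiv_of_involutions (n := n) (Fintype.card_fin _) s c
    (fun y => (hss y).1) (fun y => (hss y).2) hc2 hc (b q) (by
      intro S hS hSs hSc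
      have m1 : q ∈ S := s2 ▸ hSs _ hS
      have m3 : b (b (b q)) ∈ S := hcq ▸ hSc _ m1
      have m2 : b (b q) ∈ S := s4 ▸ hSs _ m3
      refine htr.mem_of_mapsTo hS (fun y hy => ?_) (by rwa [hmul])
      by_cases y1 : y = b q
      · rwa [y1]
      by_cases y3 : y = b (b (b q))
      · rwa [y3, h4]
      · rw [← s5 y y1 y3]; exact hSs y hy)
  have hlast : e (.inl (Fin.last (n + 1))) = b (b (b q)) := by
    rw [← hcq, ← hc2 (e _), hec]
    refine congrArg c (s.injective ?_)
    rw [hes, Fin.last_add_one, he0, s1]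
  have hcE : c = e.permCongr (modelFlip n) := by
    refine Equiv.ext fun y => ?_
    obtain ⟨i | i, rfl⟩ := e.surjective y
    · simp [hec]
    · rw [← (hc2 (e.permCongr _ _))]
      simp [hec]
  have hsE : s = e.permCongr (modelShift n) := by
    refine Equiv.ext fun y => ?_
    obtain ⟨i | i, rfl⟩ := e.surjective y
    · rw [← (hss (e.permCongr _ _)).1]
      simp [hes]
    · simp [hes]
  have hbE : b = e.permCongr (modelVertex n) := by
    rw [modelVertex, Equiv.permCongr_mul, ← hsE, Equiv.permCongr_def,
      Equiv.symm_trans_swap_trans, he0, hlast, hs, mul_assoc,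
      swap_mul_self, mul_one]
  have haE : a = e.permCongr (modelFace n) := by
    refine mul_right_cancel (b := b) ?_
    rw [hmul, hbE, ← Equiv.permCongr_mul, modelFace, inv_mul_cancel_right, hcE]
  exact ⟨e, Prod.ext haE (Prod.ext hbE hcE)⟩

/-- Proposition 2.3, row 9: for `k ≥ 2`, the number of simultaneous-conjugacy classes
of transitive triples `(σ₁, σ₂, σ₃)` in `S_{2k}` with `σ₁σ₂ = σ₃`, `σ₁` of cycle type
`(k, k-1, 1)`, `σ₂` of cycle type `(4, 2, …, 2)` and `σ₃` a fixed-point-free involution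
equals `1`. -/
theorem hurwitz_count_row9 (k : ℕ) (hk : 2 ≤ k) :
    Nat.card (Quot (SimConj
      (HurwitzTriples (2 * k) {k, k - 1, 1} (4 ::ₘ Multiset.replicate (k - 2) 2)
        (Multiset.replicate k 2)))) = 1 := by
  obtain ⟨n, rfl⟩ := Nat.exists_eq_add_of_le' hk
  rw [Nat.card_eq_one_iff_unique, show n + 2 - 1 = n + 1 from rfl, Nat.add_sub_cancel]
  constructor
  · constructor
    rintro ⟨p, hp⟩ ⟨q, hq⟩
    obtain ⟨e, rfl⟩ := exists_permCongr_eq_of_mem_hurwitzTriples hp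
    obtain ⟨e', rfl⟩ := exists_permCongr_eq_of_mem_hurwitzTriples hq
    have hconj : ∀ σ : Perm (Fin (n + 2) ⊕ Fin (n + 2)), e'.permCongr σ =
        (e.symm.trans e') * e.permCongr σ * (e.symm.trans e' : Perm (Fin (2 * (n + 2))))⁻¹ := by
      intro σ
      ext x
      simp [Perm.inv_def]
    exact Quot.sound ⟨e.symm.trans e', hconj _, hconj _, hconj _⟩
  · exact ⟨Quot.mk _ ⟨_, mem_hurwitzTriples_model n
      (finSumFinEquiv.trans (finCongr (two_mul (n + 2)).symm))⟩⟩
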